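/- arXiv:2304.09045 — 2 statements merged into one kernel-verified Lean document; each statement's English description precedes it below -/
import Mathlib

section
/- Let Γ be a finitely generated group with finite symmetric generating set S, and let γ ∈ Γ be distorted, i.e. lim_{n→∞} ℓ_S(γ^n)/n = 0. Then for every finite-dimensional unitary representation π : Γ → U(N), the matrix π(γ) has finite order. -/
open Filter Topology

/-- The word length of `γ` with respect to the generating set `S` (assumed symmetric). -/
noncomputable def wordLength {Γ : Type} [Group Γ] (S : Finset Γ) (γ : Γ) : ℕ :=
  sInf {n : ℕ | ∃ l : List Γ, l.length = n ∧ (∀ x ∈ l, x ∈ S) ∧ l.prod = γ}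

/-- A real number whose powers are bounded by a subexponential sequence is at most `1`. -/
theorem le_one_of_pow_le_pow_sublinear {r D : ℝ} {ℓ : ℕ → ℕ}
    (hℓ : Tendsto (fun n : ℕ => (ℓ n : ℝ) / n) atTop (𝓝 0))
    (h : ∀ n, r ^ n ≤ D ^ ℓ n) : r ≤ 1 := by
  by_contra! hr
  have hlog : 0 < Real.log r := Real.log_pos hr
  have hlim : Tendsto (fun n : ℕ => (ℓ n : ℝ) / n * Real.log D) atTop (𝓝 0) := by
    simpa using hℓ.mul_const (Real.log D)
  have hle : Real.log r ≤ 0 := by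
    refine ge_of_tendsto hlim ?_
    filter_upwards [eventually_gt_atTop 0] with n hn
    have hn' : (0 : ℝ) < n := by exact_mod_cast hn
    have := Real.log_le_log (by positivity) (h n)
    rw [Real.log_pow, Real.log_pow] at this
    rw [div_mul_eq_mul_div, le_div_iff₀ hn']
    linarith
  linarith

/-- Products of matrices from a finite set grow at most exponentially in the number of factors,
for any absolute value. -/
theorem exists_bound_list_prod_mulVec {L m : Type*} [Field L] [Fintype m] [DecidableEq m]
    (v : AbsoluteValue L ℝ) (T : Finset (Matrix m m L)) :
    ∃ D : ℝ, ∀ l : List (Matrix m m L), (∀ x ∈ l, x ∈ T) → ∀ (w : m → L) (c : ℝ),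
      0 ≤ c → (∀ i, v (w i) ≤ c) → ∀ i, v (l.prod.mulVec w i) ≤ D ^ l.length * c := by
  refine ⟨∑ t ∈ T, ∑ i, ∑ j, v (t i j), ?_⟩
  set D := ∑ t ∈ T, ∑ i, ∑ j, v (t i j)
  have hrow : ∀ t ∈ T, ∀ i, ∑ j, v (t i j) ≤ D := by
    intro t ht i
    have h1 : ∑ j, v (t i j) ≤ ∑ i, ∑ j, v (t i j) :=
      Finset.single_le_sum (f := fun i => ∑ j, v (t i j))
        (fun i _ => Finset.sum_nonneg fun j _ => v.nonneg _) (Finset.mem_univ i)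
    have h2 : ∑ i, ∑ j, v (t i j) ≤ ∑ t ∈ T, ∑ i, ∑ j, v (t i j) :=
      Finset.single_le_sum (f := fun t : Matrix m m L => ∑ i, ∑ j, v (t i j))
        (fun t _ => Finset.sum_nonneg fun i _ => Finset.sum_nonneg fun j _ => v.nonneg _) ht
    exact h1.trans h2
  intro l
  induction l with
  | nil => intro _ w c _ hw i; simpa using hw i
  | cons t l ih =>
    intro hl w c hc hw i
    have ihl := ih (fun x hx => hl x (List.mem_cons_of_mem _ hx)) w c hc hw
    rw [List.prod_cons, ← Matrix.mulVec_mulVec]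
    have ht := hrow t (hl t List.mem_cons_self) i
    have hD0 : 0 ≤ D := (Finset.sum_nonneg fun j _ => v.nonneg _).trans ht
    calc v ((t.mulVec (l.prod.mulVec w)) i)
        ≤ ∑ j, v (t i j * l.prod.mulVec w j) := v.sum_le _ _
      _ ≤ ∑ j, v (t i j) * (D ^ l.length * c) := by
          refine Finset.sum_le_sum fun j _ => ?_
          rw [v.map_mul]
          exact mul_le_mul_of_nonneg_left (ihl j) (v.nonneg _)
      _ = (∑ j, v (t i j)) * (D ^ l.length * c) := by rw [Finset.sum_mul]
      _ ≤ D * (D ^ l.length * c) := by gcongr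
      _ = D ^ (t :: l).length * c := by rw [List.length_cons, pow_succ]; ring

/-- Every element is represented by a word realizing its word length. -/
theorem exists_list_length_eq_wordLength {Γ : Type} [Group Γ] {S : Finset Γ}
    (hsym : ∀ s ∈ S, s⁻¹ ∈ S) (hgen : Subgroup.closure (S : Set Γ) = ⊤) (γ : Γ) :
    ∃ l : List Γ, l.length = wordLength S γ ∧ (∀ x ∈ l, x ∈ S) ∧ l.prod = γ := by
  refine Nat.sInf_mem
    (s := {n : ℕ | ∃ l : List Γ, l.length = n ∧ (∀ x ∈ l, x ∈ S) ∧ l.prod = γ}) ?_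
  have hinv : (S : Set Γ)⁻¹ ⊆ S := fun x hx => by
    simpa using hsym _ (Finset.mem_coe.1 (Set.mem_inv.1 hx))
  have hγ : γ ∈ Submonoid.closure (S : Set Γ) := by
    rw [← Set.union_eq_self_of_subset_right hinv, ← Subgroup.closure_toSubmonoid, hgen]
    trivial
  obtain ⟨l, hl, hprod⟩ := Submonoid.exists_list_of_mem_closure hγ
  exact ⟨_, l, rfl, hl, hprod⟩

/-- If a matrix representation is defined over a subring `B` of `K`, then under every
homomorphism from `B` to a field with an absolute value, the image of an eigenvalue of a
distorted element has absolute value at most `1`. -/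
theorem abv_eigenvalue_le_one {Γ : Type} [Group Γ] {S : Finset Γ}
    (hsym : ∀ s ∈ S, s⁻¹ ∈ S) (hgen : Subgroup.closure (S : Set Γ) = ⊤) {γ : Γ}
    (hdist : Tendsto (fun n : ℕ => (wordLength S (γ ^ n) : ℝ) / n) atTop (𝓝 0))
    {K B L m : Type*} [Field K] [CommRing B] [Field L] [Fintype m] [DecidableEq m]
    (ρ : Γ →* Matrix m m K) (f : B →+* K) (hf : Function.Injective f)
    (hρ : ∀ s ∈ S, ∀ i j, ρ s i j ∈ f.range)
    (x : B) (hx : (ρ γ).charpoly.IsRoot (f x)) (φ : B →+* L) (v : AbsoluteValue L ℝ) :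
    v (φ x) ≤ 1 := by
  classical
  have hlift : ∀ s, ∃ g : Matrix m m B, s ∈ S → f.mapMatrix g = ρ s := by
    intro s
    by_cases hs : s ∈ S
    · choose g hg using hρ s hs
      exact ⟨Matrix.of g, fun _ => by ext i j; simpa using hg i j⟩
    · exact ⟨0, fun h => absurd h hs⟩
  choose g hg using hlift
  have hword : ∀ l : List Γ, (∀ s ∈ l, s ∈ S) → f.mapMatrix (l.map g).prod = ρ l.prod := by
    intro l hl
    rw [map_list_prod, map_list_prod, List.map_map]
    congr 1
    exact List.map_congr_left fun s hs => hg s (hl s hs)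
  have hinj : Function.Injective (f.mapMatrix (m := m)) := Matrix.map_injective hf
  choose word hlen hmem hprod using exists_list_length_eq_wordLength hsym hgen
  set M : Matrix m m B := ((word γ).map g).prod with hM
  have hMγ : f.mapMatrix M = ρ γ := by rw [hM, hword _ (hmem γ), hprod]
  have hMpow : ∀ n, M ^ n = ((word (γ ^ n)).map g).prod := by
    intro n
    apply hinj
    rw [map_pow, hMγ, hword _ (hmem _), hprod, map_pow]
  have hroot : M.charpoly.eval x = 0 := by
    apply hf
    rw [map_zero, ← Polynomial.eval_map_apply, ← Matrix.charpoly_map]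
    rw [← hMγ] at hx
    exact hx
  have hroot' : (φ.mapMatrix M).charpoly.IsRoot (φ x) := by
    rw [Polynomial.IsRoot, RingHom.mapMatrix_apply, Matrix.charpoly_map,
      Polynomial.eval_map_apply, hroot, map_zero]
  rw [Polynomial.IsRoot, Matrix.eval_charpoly, ← Matrix.exists_mulVec_eq_zero_iff] at hroot'
  obtain ⟨w, hw0, hw⟩ := hroot'
  have hw1 : (φ.mapMatrix M).mulVec w = φ x • w := by
    rw [Matrix.sub_mulVec, sub_eq_zero] at hw
    rw [← hw]
    simp [Matrix.scalar_apply]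
  have hwn : ∀ n : ℕ, (φ.mapMatrix M ^ n).mulVec w = (φ x) ^ n • w := by
    intro n
    induction n with
    | zero => simp
    | succ n ih =>
      rw [pow_succ, ← Matrix.mulVec_mulVec, hw1, Matrix.mulVec_smul, ih, smul_smul, pow_succ']
  obtain ⟨D, hD⟩ := exists_bound_list_prod_mulVec v
    (S.image fun s => φ.mapMatrix (g s))
  obtain ⟨k, hk⟩ := Function.ne_iff.1 hw0
  obtain ⟨i₀, -, hi₀⟩ :=
    Finset.exists_max_image Finset.univ (fun i => v (w i)) ⟨k, Finset.mem_univ k⟩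
  have hpos : 0 < v (w i₀) := (v.pos hk).trans_le (hi₀ k (Finset.mem_univ k))
  refine le_one_of_pow_le_pow_sublinear (D := D) hdist fun n => ?_
  have h := hD (((word (γ ^ n)).map g).map φ.mapMatrix)
    (by
      intro y hy
      simp only [List.map_map, List.mem_map] at hy
      obtain ⟨s, hs, rfl⟩ := hy
      exact Finset.mem_image_of_mem _ (hmem _ s hs))
    w (v (w i₀)) hpos.le (fun i => hi₀ i (Finset.mem_univ i)) i₀
  rw [← map_list_prod, ← hMpow, map_pow, hwn, List.length_map, List.length_map, hlen,
    Pi.smul_apply, smul_eq_mul, v.map_mul, v.map_pow] at h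
  exact le_of_mul_le_mul_right h hpos

/-- A nonzero algebra of finite type over a field has a point over a finite extension. -/
theorem exists_algHom_finiteDimensional (F B : Type) [Field F] [CommRing B] [Nontrivial B]
    [Algebra F B] [Algebra.FiniteType F B] :
    ∃ (L : Type) (_ : Field L) (_ : Algebra F L), FiniteDimensional F L ∧ Nonempty (B →ₐ[F] L) := by
  obtain ⟨I, hI⟩ := Ideal.exists_maximal B
  let := Ideal.Quotient.field I
  exact ⟨B ⧸ I, inferInstance, inferInstance, finite_of_finite_type_of_isJacobsonRing F (B ⧸ I),
    ⟨Ideal.Quotient.mkₐ F I⟩⟩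

/-- An element of a number field is an algebraic integer as soon as every absolute value of it
is at most `1`. -/
theorem isIntegral_of_forall_abv_le_one {L : Type*} [Field L] [NumberField L] {x : L}
    (h : ∀ v : AbsoluteValue L ℝ, v x ≤ 1) : IsIntegral ℤ x := by
  have hx : x ∈ (algebraMap (NumberField.RingOfIntegers L) L).range := by
    refine IsDedekindDomain.HeightOneSpectrum.mem_integers_of_valuation_le_one L x fun v => ?_
    have hb := NumberField.HeightOneSpectrum.one_lt_absNorm_nnreal v
    have hle : v.adicAbvDef hb x ≤ 1 := h (v.adicAbv hb)
    rwa [IsDedekindDomain.HeightOneSpectrum.adicAbvDef,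
      WithZeroMulInt.toNNReal_le_one_iff hb] at hle
  obtain ⟨y, rfl⟩ := hx
  exact NumberField.RingOfIntegers.isIntegral_coe y

/-- The field generated by a transcendental element embeds over the base field so that its
generator is sent to any given transcendental element. -/
theorem exists_algHom_adjoin_map_gen_eq {k E : Type*} [Field k] [Field E] [Algebra k E] {a b : E}
    (ha : Transcendental k a) (hb : Transcendental k b) :
    ∃ σ : IntermediateField.adjoin k {a} →ₐ[k] E,
      σ (IntermediateField.AdjoinSimple.gen k a) = b := by
  let e₁ := RatFunc.algEquivOfTranscendental a ha
  let e₂ := RatFunc.algEquivOfTranscendental b hb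
  refine ⟨(IntermediateField.val _).comp (e₂.toAlgHom.comp e₁.symm.toAlgHom), ?_⟩
  change ((e₂ (e₁.symm _) : IntermediateField.adjoin k {b}) : E) = _
  rw [RatFunc.algEquivOfTranscendental_symm_gen]
  exact RatFunc.algEquivOfTranscendental_X b hb

/-- Embeddings into an algebraically closed field extend along algebraic extensions. -/
theorem exists_ringHom_extending_of_isAlgebraic {F L K : Type*} [Field F] [Field L] [Field K]
    [IsAlgClosed K] [Algebra F L] [Algebra.IsAlgebraic F L] (σ : F →+* K) :
    ∃ ψ : L →+* K, ∀ a, ψ (algebraMap F L a) = σ a := by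
  let := σ.toAlgebra
  let ψ : L →ₐ[F] K := IsAlgClosed.lift
  exact ⟨ψ, ψ.commutes⟩

/-- Eigenvalues of the image of a distorted element under an invertible complex matrix
representation are roots of unity. -/
theorem eigenvalue_pow_eq_one_of_distorted {Γ : Type} [Group Γ] {S : Finset Γ}
    (hsym : ∀ s ∈ S, s⁻¹ ∈ S) (hgen : Subgroup.closure (S : Set Γ) = ⊤) {γ : Γ}
    (hdist : Tendsto (fun n : ℕ => (wordLength S (γ ^ n) : ℝ) / n) atTop (𝓝 0))
    {m : Type} [Fintype m] [DecidableEq m] (ρ : Γ →* Matrix m m ℂ) {z : ℂ}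
    (hz : (ρ γ).charpoly.IsRoot z) : ∃ n : ℕ, 0 < n ∧ z ^ n = 1 := by
  classical
  have hz0 : z ≠ 0 := by
    rintro rfl
    have hdet : IsUnit (ρ γ).det :=
      (Matrix.isUnit_iff_isUnit_det _).1 ((Group.isUnit γ).map ρ)
    rw [Polynomial.IsRoot, Matrix.eval_charpoly] at hz
    simp [Matrix.det_neg, hdet.ne_zero] at hz
  let F := IntermediateField.adjoin ℚ {z}
  let x : F := IntermediateField.AdjoinSimple.gen ℚ z
  let E : Finset ℂ := S.biUnion fun s => Finset.univ.image fun p : m × m => ρ s p.1 p.2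
  let B := Algebra.adjoin F (E : Set ℂ)
  have : Algebra.FiniteType F B := B.fg_iff_finiteType.1 (Subalgebra.fg_adjoin_finset E)
  have hρ : ∀ s ∈ S, ∀ i j, ρ s i j ∈ (B.val : B →+* ℂ).range := fun s hs i j =>
    ⟨⟨ρ s i j, Algebra.subset_adjoin (Finset.mem_coe.2 (Finset.mem_biUnion.2
      ⟨s, hs, Finset.mem_image.2 ⟨(i, j), Finset.mem_univ _, rfl⟩⟩))⟩, rfl⟩
  obtain ⟨L, _, _, _, ⟨φ⟩⟩ := exists_algHom_finiteDimensional F B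
  have key : ∀ {L' : Type} [Field L'] (ψ : L →+* L') (v : AbsoluteValue L' ℝ),
      v (ψ (algebraMap F L x)) ≤ 1 := by
    intro L' _ ψ v
    have := abv_eigenvalue_le_one hsym hgen hdist ρ (B.val : B →+* ℂ) Subtype.val_injective hρ
      (algebraMap F B x) hz (ψ.comp (φ : B →+* L)) v
    simpa using this
  by_cases halg : Transcendental ℚ z
  · exfalso
    obtain ⟨c, hc⟩ := exists_nat_gt (‖z‖⁻¹)
    have hzpos : 0 < ‖z‖ := norm_pos_iff.2 hz0
    have hc0 : (0 : ℝ) < c := (inv_pos.2 hzpos).trans hc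
    have hcz : Transcendental ℚ (c * z) := by
      intro h
      have hcC : (c : ℂ) ≠ 0 := by exact_mod_cast hc0.ne'
      refine halg ?_
      rw [← inv_mul_cancel_left₀ hcC z]
      exact (isAlgebraic_algebraMap (c : ℚ)).inv.mul h
    obtain ⟨σ, hσ⟩ := exists_algHom_adjoin_map_gen_eq halg hcz
    obtain ⟨ψ, hψ⟩ := exists_ringHom_extending_of_isAlgebraic (L := L) (σ : F →+* ℂ)
    have h : ‖ψ (algebraMap F L x)‖ ≤ 1 := key ψ (NormedField.toAbsoluteValue ℂ)
    rw [hψ, RingHom.coe_coe, hσ, norm_mul, Complex.norm_natCast] at h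
    have := (inv_lt_iff_one_lt_mul₀ hzpos).1 hc
    linarith
  · have hint : IsIntegral ℚ z := (not_not.1 halg : IsAlgebraic ℚ z).isIntegral
    have : FiniteDimensional ℚ F := IntermediateField.adjoin.finiteDimensional hint
    have : CharZero L := charZero_of_injective_algebraMap (algebraMap F L).injective
    have : FiniteDimensional ℚ L := FiniteDimensional.trans ℚ F L
    have : NumberField L := ⟨⟩
    have hx0 : algebraMap F L x ≠ 0 := by
      rw [Ne, map_eq_zero]
      exact fun h => hz0 (congrArg Subtype.val h)
    obtain ⟨n, hn, hpow⟩ := NumberField.Embeddings.pow_eq_one_of_norm_le_one L ℂ hx0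
      (isIntegral_of_forall_abv_le_one fun v => key (RingHom.id L) v)
      (fun ψ => key ψ (NormedField.toAbsoluteValue ℂ))
    refine ⟨n, hn, ?_⟩
    rw [← map_pow, map_eq_one_iff _ (algebraMap F L).injective] at hpow
    exact congrArg Subtype.val hpow

open scoped Matrix.Norms.L2Operator in
/-- A unitary matrix whose eigenvalues are all roots of unity has finite order. -/
theorem isOfFinOrder_of_spectrum_pow_eq_one {m : Type*} [Fintype m] [DecidableEq m]
    (U : Matrix.unitaryGroup m ℂ)
    (h : ∀ z ∈ spectrum ℂ (U : Matrix m m ℂ), ∃ n : ℕ, 0 < n ∧ z ^ n = 1) : IsOfFinOrder U := by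
  have hfin := Matrix.finite_spectrum (U : Matrix m m ℂ)
  have : ∃ n : ℕ, 0 < n ∧ ∀ z ∈ spectrum ℂ (U : Matrix m m ℂ), z ^ n = 1 := by
    choose! k hk0 hk using h
    refine ⟨∏ z ∈ hfin.toFinset, k z, Finset.prod_pos fun z hz => hk0 z (hfin.mem_toFinset.1 hz),
      fun z hz => ?_⟩
    obtain ⟨d, hd⟩ := Finset.dvd_prod_of_mem k (hfin.mem_toFinset.2 hz)
    rw [hd, pow_mul, hk z hz, one_pow]
  obtain ⟨n, hn, hpow⟩ := this
  refine isOfFinOrder_iff_pow_eq_one.2 ⟨n, hn, Subtype.ext ?_⟩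
  refine CFC.eq_one_of_spectrum_subset_one (R := ℂ) (p := IsStarNormal) _ ?_ ?_
  · rw [SubmonoidClass.coe_pow, spectrum.map_pow_of_pos _ hn]
    rintro _ ⟨z, hz, rfl⟩
    exact hpow z hz
  · exact isStarNormal_of_mem_unitary (U ^ n).2

/-- a distorted element of a finitely generated group has finite order under
every finite-dimensional unitary representation. -/
theorem distorted_elt_finite_order_in_unitary_reps {Γ : Type} [Group Γ] (S : Finset Γ)
    (hsym : ∀ s ∈ S, s⁻¹ ∈ S) (hgen : Subgroup.closure (S : Set Γ) = ⊤) (γ : Γ)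
    (hdist : Tendsto (fun n : ℕ => (wordLength S (γ ^ n) : ℝ) / n) atTop (𝓝 0)) :
    ∀ (N : ℕ) (π : Γ →* Matrix.unitaryGroup (Fin N) ℂ), IsOfFinOrder (π γ) := by
  intro N π
  refine isOfFinOrder_of_spectrum_pow_eq_one _ fun z hz => ?_
  exact eigenvalue_pow_eq_one_of_distorted hsym hgen hdist
    ((Matrix.unitaryGroup (Fin N) ℂ).subtype.comp π) (Matrix.mem_spectrum_iff_isRoot_charpoly.1 hz)
end

section
/- Let Γ be a finitely generated nilpotent group. Every irreducible finite-dimensional unitary representation π of Γ is of the form π = χ ⊗ ρ, where χ is a unitary character of the abelianization Γ^Ab = Γ/[Γ,Γ] (pulled back to Γ) and ρ is an irreducible finite-dimensional unitary representation of Γ with finite image. -/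
/-- A finite-dimensional unitary representation is irreducible if the only invariant subspaces
are `⊥` and `⊤`. -/
def IsIrreducibleRep {Γ : Type} [Group Γ] {n : ℕ} (π : Γ →* Matrix.unitaryGroup (Fin n) ℂ) :
    Prop :=
  (0 < n) ∧ ∀ W : Submodule ℂ (Fin n → ℂ),
    (∀ γ : Γ, ∀ v ∈ W, (π γ : Matrix (Fin n) (Fin n) ℂ).mulVec v ∈ W) → W = ⊥ ∨ W = ⊤

open scoped commutatorElement ComplexOrder

/-- If the commutator of `x` and `y` commutes with `x`, then `⁅·, y⁆` is multiplicative on powers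
of `x`. -/
theorem commutatorElement_pow_left {G : Type*} [Group G] {x y : G} (h : Commute ⁅x, y⁆ x) (N : ℕ) :
    ⁅x ^ N, y⁆ = ⁅x, y⁆ ^ N := by
  have hconj : y * x⁻¹ * y⁻¹ = x⁻¹ * ⁅x, y⁆ := by
    simp [commutatorElement_def, mul_assoc]
  have hc : Commute x⁻¹ ⁅x, y⁆ := h.symm.inv_left
  calc ⁅x ^ N, y⁆ = x ^ N * (y * x⁻¹ * y⁻¹) ^ N := by
        rw [conj_pow, commutatorElement_def, inv_pow]; simp only [mul_assoc]
    _ = ⁅x, y⁆ ^ N := by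
        rw [hconj, hc.mul_pow, ← mul_assoc, inv_pow, mul_inv_cancel, one_mul]

namespace Subgroup

theorem pow_mem_upperCentralSeries {G : Type*} [Group G] {N : ℕ}
    (h : ∀ x ∈ upperCentralSeries G 2, x ^ N ∈ upperCentralSeries G 1) (i : ℕ) :
    ∀ x ∈ upperCentralSeries G (i + 2), x ^ N ∈ upperCentralSeries G (i + 1) := by
  induction i with
  | zero => exact h
  | succ i ih =>
    intro x hx
    rw [mem_upperCentralSeries_succ_iff]
    intro y
    have hxy := mem_upperCentralSeries_succ_iff.1 hx y
    let q := QuotientGroup.mk' (upperCentralSeries G (i + 1))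
    have hcomm : Commute ⁅q x, q y⁆ (q x) := by
      rw [← commutatorElement_eq_one_iff_commute, ← map_commutatorElement, ← map_commutatorElement]
      exact (QuotientGroup.eq_one_iff _).2 (mem_upperCentralSeries_succ_iff.1 hxy x)
    have hq : q ⁅x ^ N, y⁆ = q (⁅x, y⁆ ^ N) := by
      simpa only [map_commutatorElement, map_pow] using commutatorElement_pow_left hcomm N
    have hq1 : q (⁅x, y⁆ ^ N) = 1 := (QuotientGroup.eq_one_iff _).2 (ih _ hxy)
    exact (QuotientGroup.eq_one_iff _).1 (hq.trans hq1)

theorem exists_pow_mem_center_of_isNilpotent {G : Type*} [Group G] [Group.IsNilpotent G] {N : ℕ}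
    (h : ∀ x ∈ upperCentralSeries G 2, x ^ N ∈ upperCentralSeries G 1) :
    ∃ k : ℕ, ∀ x : G, x ^ N ^ k ∈ center G := by
  obtain ⟨k, hk⟩ := Group.IsNilpotent.nilpotent G
  have key (i : ℕ) : ∀ x ∈ upperCentralSeries G (i + 1), x ^ N ^ i ∈ center G := by
    induction i with
    | zero => simp [upperCentralSeries_one]
    | succ i ih =>
      intro x hx
      rw [pow_succ', pow_mul]
      exact ih _ (pow_mem_upperCentralSeries h i x hx)
  refine ⟨k, fun x => key k x (upperCentralSeries_mono G k.le_succ ?_)⟩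
  rw [hk]
  exact mem_top x

end Subgroup

/-- A homomorphism from a finitely generated abelian group to a group with `n`-th roots has an
`n`-th root up to torsion. -/
theorem MonoidHom.exists_pow_pow_eq_pow {A C : Type*} [CommGroup A] [Group.FG A] [CommGroup C]
    {n : ℕ} (hroot : ∀ z : C, ∃ w : C, w ^ n = z) (D : A →* C) :
    ∃ χ : A →* C, ∃ M : ℕ, 0 < M ∧ ∀ a, (χ a ^ n) ^ M = D a ^ M := by
  classical
  obtain ⟨ι, j, _, _, p, hp, k, ⟨e⟩⟩ := CommGroup.equiv_free_prod_prod_multiplicative_zmod A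
  have (i : ι) : NeZero (p i ^ k i) := ⟨pow_ne_zero _ (hp i).ne_zero⟩
  choose r hr using hroot
  let D₀ : (j → Multiplicative ℤ) →* C := (D.comp e.symm.toMonoidHom).comp (MonoidHom.inl _ _)
  let χ₀ : (j → Multiplicative ℤ) →* C := ∏ i, (zpowersHom C
    (r (D₀ (Pi.mulSingle i (Multiplicative.ofAdd 1))))).comp (Pi.evalMonoidHom _ i)
  have hχ₀ (x : j → Multiplicative ℤ) : χ₀ x ^ n = D₀ x := by
    have : (powMonoidHom n).comp χ₀ = D₀ := by
      refine MonoidHom.functions_ext' _ _ _ fun i => MonoidHom.ext_mint ?_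
      simp only [χ₀, MonoidHom.comp_apply, MonoidHom.finsetProd_apply, powMonoidHom_apply,
        Pi.evalMonoidHom_apply, MonoidHom.mulSingle_apply]
      rw [Finset.prod_eq_single i]
      · simp [hr]
      · intro b _ hb
        simp [Pi.mulSingle_eq_of_ne hb]
      · simp
    exact DFunLike.congr_fun this x
  refine ⟨χ₀.comp ((MonoidHom.fst _ _).comp e.toMonoidHom),
    Nat.card (∀ i, Multiplicative (ZMod (p i ^ k i))), Nat.card_pos, fun a => ?_⟩
  have ha : e a ^ Nat.card (∀ i, Multiplicative (ZMod (p i ^ k i))) =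
      ((e a).1 ^ Nat.card (∀ i, Multiplicative (ZMod (p i ^ k i))), 1) :=
    Prod.ext rfl pow_card_eq_one'
  simp only [MonoidHom.comp_apply, hχ₀]
  rw [← map_pow, ← map_pow D]
  change D (e.symm ((e a).1 ^ _, 1)) = _
  rw [← ha, ← map_pow, e.symm_apply_apply]

theorem Circle.exists_pow_eq {n : ℕ} (hn : n ≠ 0) (z : Circle) : ∃ w : Circle, w ^ n = z := by
  refine ⟨Circle.exp (Complex.arg z / n), ?_⟩
  rw [← Circle.exp_nsmul, nsmul_eq_mul, mul_div_cancel₀ _ (Nat.cast_ne_zero.2 hn), Circle.exp_arg]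

namespace Matrix

theorem finite_trace_image_of_pow_eq_one {m : Type*} [Fintype m] [DecidableEq m] {N : ℕ}
    (hN : 0 < N) : (trace '' {g : Matrix m m ℂ | g ^ N = 1}).Finite := by
  classical
  let F : Finset ℂ := (Polynomial.nthRoots N (1 : ℂ)).toFinset
  refine ((Set.finite_Iic (Fintype.card m • F.val)).image Multiset.sum).subset ?_
  rintro _ ⟨g, hg, rfl⟩
  refine ⟨g.charpoly.roots, ?_, (trace_eq_sum_roots_charpoly g).symm⟩
  rw [Set.mem_Iic, Multiset.le_iff_count]
  intro a
  by_cases ha : a ∈ g.charpoly.roots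
  · have hspec : a ∈ spectrum ℂ g :=
      mem_spectrum_of_isRoot_charpoly (Polynomial.isRoot_of_mem_roots ha)
    have haN : a ^ N = 1 := by
      have hpow : a ^ N ∈ spectrum ℂ (g ^ N) := spectrum.pow_mem_pow g N hspec
      rw [show g ^ N = 1 from hg] at hpow
      have : Nontrivial (Matrix m m ℂ) := by
        by_contra hnt
        rw [not_nontrivial_iff_subsingleton] at hnt
        simp [spectrum.of_subsingleton] at hspec
      simpa [spectrum.one_eq] using hpow
    have haF : 1 ≤ F.val.count a := by
      rw [Multiset.one_le_count_iff_mem, Finset.mem_val, Multiset.mem_toFinset,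
        Polynomial.mem_nthRoots hN]
      exact haN
    calc g.charpoly.roots.count a ≤ g.charpoly.roots.card := Multiset.count_le_card _ _
      _ ≤ Fintype.card m := (Polynomial.card_roots' _).trans (charpoly_natDegree_eq_dim g).le
      _ ≤ (Fintype.card m • F.val).count a := by
        rw [Multiset.count_nsmul]
        exact Nat.le_mul_of_pos_right _ haF
  · simp [Multiset.count_eq_zero_of_notMem ha]

/-- A group of unitary matrices of finite exponent is finite. -/
theorem finite_of_forall_pow_eq_one {m : Type*} [Fintype m] [DecidableEq m]
    (H : Subgroup (unitaryGroup m ℂ)) {N : ℕ} (hN : 0 < N) (hH : ∀ h ∈ H, h ^ N = 1) :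
    Finite H := by
  let s : Set (Matrix m m ℂ) := Set.range fun h : H => ((h : unitaryGroup m ℂ) : Matrix m m ℂ)
  obtain ⟨b, hbs, hspan, hli⟩ := exists_linearIndependent ℂ s
  have : Finite b := hli.setFinite
  let T : Set ℂ := trace '' {g : Matrix m m ℂ | g ^ N = 1}
  have : Finite T := (finite_trace_image_of_pow_eq_one hN).to_subtype
  have hT (h : H) (k : b) :
      (((h : unitaryGroup m ℂ) : Matrix m m ℂ) * (k : Matrix m m ℂ)).trace ∈ T := by
    obtain ⟨k', hk'⟩ := hbs k.2
    refine ⟨_, ?_, rfl⟩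
    rw [Set.mem_ofPred_eq, ← hk']
    exact congrArg Subtype.val (hH _ (h * k').2)
  refine Finite.of_injective (fun (h : H) (k : b) => (⟨_, hT h k⟩ : T)) fun h h' hhh' => ?_
  set x : Matrix m m ℂ := ((h : unitaryGroup m ℂ) : Matrix m m ℂ) - (h' : unitaryGroup m ℂ)
    with hx
  have hle : Submodule.span ℂ s ≤
      LinearMap.ker ((traceLinearMap m ℂ ℂ).comp (LinearMap.mulLeft ℂ x)) := by
    rw [← hspan, Submodule.span_le]
    intro k hk
    have := congrArg Subtype.val (congrFun hhh' ⟨k, hk⟩)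
    simpa [x, sub_mul, sub_eq_zero] using this
  have hstar : xᴴ ∈ Submodule.span ℂ s := by
    rw [hx, conjTranspose_sub]
    exact sub_mem (Submodule.subset_span ⟨h⁻¹, rfl⟩) (Submodule.subset_span ⟨h'⁻¹, rfl⟩)
  have hx0 : x = 0 := trace_mul_conjTranspose_self_eq_zero_iff.1 (hle hstar)
  exact Subtype.ext (Subtype.ext (sub_eq_zero.1 hx0))

end Matrix

/-- Schur's lemma: a matrix commuting with an irreducible representation is scalar. -/
theorem IsIrreducibleRep.exists_eq_smul_one {Γ : Type} [Group Γ] {n : ℕ}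
    {π : Γ →* Matrix.unitaryGroup (Fin n) ℂ} (hirr : IsIrreducibleRep π)
    {A : Matrix (Fin n) (Fin n) ℂ}
    (hA : ∀ γ, A * (π γ : Matrix (Fin n) (Fin n) ℂ) = (π γ : Matrix (Fin n) (Fin n) ℂ) * A) :
    ∃ c : ℂ, A = c • (1 : Matrix (Fin n) (Fin n) ℂ) := by
  have : Nonempty (Fin n) := ⟨⟨0, hirr.1⟩⟩
  obtain ⟨c, hc⟩ := Module.End.exists_eigenvalue (Matrix.toLin' A)
  refine ⟨c, ?_⟩
  rcases hirr.2 (Module.End.eigenspace (Matrix.toLin' A) c) fun γ v hv => by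
    rw [Module.End.mem_eigenspace_iff, Matrix.toLin'_apply] at hv ⊢
    rw [Matrix.mulVec_mulVec, hA, ← Matrix.mulVec_mulVec, hv, Matrix.mulVec_smul] with h | h
  · exact absurd h hc
  · ext j i
    have hi := Module.End.mem_eigenspace_iff.1 (h ▸ Submodule.mem_top (x := Pi.single i (1 : ℂ)))
    simpa [Matrix.one_apply, Pi.single_apply] using congrFun hi j

/-- Some power of every element of an irreducible nilpotent group of matrices is scalar, with a
uniform exponent. -/
theorem IsIrreducibleRep.exists_pow_eq_smul_one {Γ : Type} [Group Γ] [Group.IsNilpotent Γ] {n : ℕ}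
    {π : Γ →* Matrix.unitaryGroup (Fin n) ℂ} (hirr : IsIrreducibleRep π) :
    ∃ N : ℕ, 0 < N ∧ ∀ γ, ∃ c : ℂ,
      (π γ : Matrix (Fin n) (Fin n) ℂ) ^ N = c • (1 : Matrix (Fin n) (Fin n) ℂ) := by
  have : Group.IsNilpotent π.range :=
    Group.nilpotent_of_surjective π.rangeRestrict π.rangeRestrict_surjective
  have schur (z : π.range) (hz : z ∈ Subgroup.center π.range) : ∃ c : ℂ,
      ((z : Matrix.unitaryGroup (Fin n) ℂ) : Matrix (Fin n) (Fin n) ℂ) = c • 1 :=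
    hirr.exists_eq_smul_one fun γ => (congrArg (fun g : π.range =>
      ((g : Matrix.unitaryGroup (Fin n) ℂ) : Matrix (Fin n) (Fin n) ℂ))
      (Subgroup.mem_center_iff.1 hz ⟨π γ, γ, rfl⟩)).symm
  have hbase : ∀ x ∈ Subgroup.upperCentralSeries π.range 2,
      x ^ n ∈ Subgroup.upperCentralSeries π.range 1 := by
    intro x hx
    rw [Subgroup.upperCentralSeries_one, Subgroup.mem_center_iff]
    intro y
    have hxy := Subgroup.mem_upperCentralSeries_succ_iff.1 hx y
    rw [Subgroup.upperCentralSeries_one] at hxy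
    obtain ⟨c, hc⟩ := schur _ hxy
    let d : π.range →* ℂ := Matrix.detMonoidHom.comp
      ((Submonoid.subtype _).comp π.range.subtype)
    have hd : d ⁅x, y⁆ = 1 := by
      rw [commutatorElement_def, map_mul, map_mul, map_mul, mul_right_comm (d x), ← map_mul,
        mul_inv_cancel, map_one, one_mul, ← map_mul, mul_inv_cancel, map_one]
    have hcn : c ^ n = 1 := by
      have : d ⁅x, y⁆ = c ^ n := by
        change (((⁅x, y⁆ : π.range) : Matrix.unitaryGroup (Fin n) ℂ) :
          Matrix (Fin n) (Fin n) ℂ).det = _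
        rw [hc]
        simp
      rw [← this, hd]
    have hpow : ⁅x, y⁆ ^ n = 1 := by
      apply Subtype.ext
      apply Subtype.ext
      change (((⁅x, y⁆ : π.range) : Matrix.unitaryGroup (Fin n) ℂ) :
        Matrix (Fin n) (Fin n) ℂ) ^ n = 1
      rw [hc, smul_pow, hcn, one_pow, one_smul]
    have hcomm : Commute ⁅x, y⁆ x := (Subgroup.mem_center_iff.1 hxy x).symm
    rw [← commutatorElement_pow_left hcomm, commutatorElement_eq_one_iff_mul_comm] at hpow
    exact hpow.symm
  obtain ⟨k, hk⟩ := Subgroup.exists_pow_mem_center_of_isNilpotent hbase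
  exact ⟨n ^ k, pow_pos hirr.1 k, fun γ => schur _ (hk ⟨π γ, γ, rfl⟩)⟩

/-- The determinant of a unitary representation, as a unitary character. -/
noncomputable def detCharacter {Γ : Type*} [Group Γ] {m : Type*} [Fintype m] [DecidableEq m]
    (π : Γ →* Matrix.unitaryGroup m ℂ) : Γ →* Circle where
  toFun γ := ⟨(π γ : Matrix m m ℂ).det, by
    exact mem_sphere_zero_iff_norm.2
      (CStarRing.norm_of_mem_unitary (Matrix.det_of_mem_unitary (π γ).2))⟩
  map_one' := by ext; simp
  map_mul' a b := by
    apply Circle.ext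
    change (π (a * b) : Matrix m m ℂ).det = (π a : Matrix m m ℂ).det * (π b : Matrix m m ℂ).det
    rw [map_mul]
    exact Matrix.det_mul _ _

/-- The twist of a unitary representation by a unitary character. -/
noncomputable def twist {Γ : Type*} [Group Γ] {m : Type*} [Fintype m] [DecidableEq m] (χ : Γ →* Circle)
    (π : Γ →* Matrix.unitaryGroup m ℂ) : Γ →* Matrix.unitaryGroup m ℂ where
  toFun γ := ⟨(χ γ : ℂ) • (π γ : Matrix m m ℂ), by
    have h : (χ γ : ℂ) * star (χ γ : ℂ) = 1 := by
      simp [Complex.mul_conj, Circle.normSq_coe]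
    rw [Matrix.mem_unitaryGroup_iff, star_smul, smul_mul_smul_comm, h,
      Matrix.mem_unitaryGroup_iff.1 (π γ).2, one_smul]⟩
  map_one' := by ext; simp
  map_mul' a b := by
    apply Subtype.ext
    simp [smul_smul, mul_comm]

/-- every irreducible finite-dimensional unitary representation of a finitely
generated nilpotent group is a unitary character of the abelianization tensored with an
irreducible representation with finite image. -/
theorem irreducible_rep_eq_char_tensor_finite {Γ : Type} [Group Γ] [Group.FG Γ]
    [Group.IsNilpotent Γ] {n : ℕ} (π : Γ →* Matrix.unitaryGroup (Fin n) ℂ)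
    (hirr : IsIrreducibleRep π) :
    ∃ (χ : Γ →* Circle) (ρ : Γ →* Matrix.unitaryGroup (Fin n) ℂ),
      commutator Γ ≤ χ.ker ∧ (Set.range ρ).Finite ∧ IsIrreducibleRep ρ ∧
      ∀ γ : Γ, (π γ : Matrix (Fin n) (Fin n) ℂ) = (χ γ : ℂ) • (ρ γ : Matrix (Fin n) (Fin n) ℂ) := by
  have hn : 0 < n := hirr.1
  have : Group.FG (Abelianization Γ) :=
    Group.fg_of_surjective (f := Abelianization.of) (QuotientGroup.mk'_surjective _)
  obtain ⟨χ', M, hM, hχ'⟩ := MonoidHom.exists_pow_pow_eq_pow (Circle.exists_pow_eq hn.ne')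
    (Abelianization.lift (detCharacter π))
  obtain ⟨N, hN, hscalar⟩ := hirr.exists_pow_eq_smul_one
  let χ : Γ →* Circle := χ'.comp Abelianization.of
  have hχ (γ : Γ) : ((χ γ : ℂ) ^ n) ^ M = (π γ : Matrix (Fin n) (Fin n) ℂ).det ^ M :=
    congrArg ((↑) : Circle → ℂ) (hχ' (Abelianization.of γ))
  have hπ (γ : Γ) : (π γ : Matrix (Fin n) (Fin n) ℂ) =
      (χ γ : ℂ) • (twist χ⁻¹ π γ : Matrix (Fin n) (Fin n) ℂ) := by
    simp [twist, smul_smul]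
  refine ⟨χ, twist χ⁻¹ π, Abelianization.commutator_subset_ker χ, ?_, ⟨hn, fun W hW => ?_⟩, hπ⟩
  · rw [← MonoidHom.coe_range]
    refine @Set.toFinite _ _ (Matrix.finite_of_forall_pow_eq_one _
      (N := N * (n * M)) (by positivity) ?_)
    rintro _ ⟨γ, rfl⟩
    obtain ⟨c, hc⟩ := hscalar γ
    set z : ℂ := ((χ γ : ℂ)⁻¹) ^ N * c
    have hz : (twist χ⁻¹ π γ : Matrix (Fin n) (Fin n) ℂ) ^ N = z • 1 := by
      simp [twist, smul_pow, hc, smul_smul, z]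
    have hdet : (twist χ⁻¹ π γ : Matrix (Fin n) (Fin n) ℂ).det ^ M = 1 := by
      have hne : (χ γ : ℂ) ≠ 0 := (χ γ).coe_ne_zero
      simp only [twist, MonoidHom.coe_mk, OneHom.coe_mk, Matrix.det_smul, Fintype.card_fin,
        mul_pow, ← hχ]
      simp [hne]
    have hz1 : z ^ (n * M) = 1 := by
      have := congrArg (fun A => A.det ^ M) hz
      simpa [Matrix.det_pow, ← pow_mul, mul_comm N M, pow_mul _ M N, hdet] using this.symm
    apply Subtype.ext
    change (twist χ⁻¹ π γ : Matrix (Fin n) (Fin n) ℂ) ^ (N * (n * M)) = 1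
    rw [pow_mul, hz, smul_pow, hz1, one_pow, one_smul]
  · refine hirr.2 W fun γ v hv => ?_
    rw [hπ, Matrix.smul_mulVec]
    exact W.smul_mem _ (hW γ v hv)
end
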